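/- For every δ > 0 there exists N such that for all n ≥ N: every monotone circuit computing Match_n has size at least 2^(n^(1/3 − δ)). -/

import Mathlib

/-- A monotone circuit (straight-line program) with input bits indexed by `ι`:
gate `i` is either an input variable, or the AND (`true`) / OR (`false`) of two
earlier gates. Its size is the number of gates. -/
structure MonCircuit (ι : Type) where
  size : ℕ
  gate : (i : Fin size) → ι ⊕ (Bool × Fin i.val × Fin i.val)

/-- Evaluation of the gates of a monotone circuit on input `x`. -/
def MonCircuit.eval {ι : Type} (C : MonCircuit ι) (x : ι → Bool) : (i : Fin C.size) → Bool
  | i =>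
    match C.gate i with
    | Sum.inl j => x j
    | Sum.inr (op, j, k) =>
      let a := C.eval x ⟨j.val, j.isLt.trans i.isLt⟩
      let b := C.eval x ⟨k.val, k.isLt.trans i.isLt⟩
      if op then a && b else a || b
  termination_by i => i.val

/-- `C` computes the boolean function `f` (given as a predicate on inputs):
the circuit is nonempty and its last gate outputs `true` exactly on inputs satisfying `f`. -/
def MonCircuit.Computes {ι : Type} (C : MonCircuit ι) (f : (ι → Bool) → Prop) : Prop :=
  ∃ h : 0 < C.size, ∀ x : ι → Bool,
    (C.eval x ⟨C.size - 1, Nat.sub_lt h Nat.one_pos⟩ = true ↔ f x)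

/-- A matching in `K_{n,n}`: a set of edges with pairwise distinct left endpoints
and pairwise distinct right endpoints. -/
def IsMatching {n : ℕ} (M : Finset (Fin n × Fin n)) : Prop :=
  ∀ e ∈ M, ∀ e' ∈ M, e ≠ e' → e.1 ≠ e'.1 ∧ e.2 ≠ e'.2

/-- `Match n x = 1` iff the bipartite graph `x ⊆ L × R` contains a perfect matching. -/
def MatchProp (n : ℕ) (x : Fin n × Fin n → Bool) : Prop :=
  ∃ M : Finset (Fin n × Fin n), IsMatching M ∧ M.card = n ∧ ∀ e ∈ M, x e = true

open Finset

theorem choose_two_mul_le (m j : ℕ) :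
    (2 * m).choose (2 * j) ≤ m.choose j * (2 * m) ^ j := by
  induction j with
  | zero => simp
  | succ j ih =>
    rcases Nat.lt_or_ge j m with hj | hj
    · have h1 := Nat.choose_succ_right_eq (2 * m) (2 * j)
      have h2 := Nat.choose_succ_right_eq (2 * m) (2 * j + 1)
      have h3 := Nat.choose_succ_right_eq m j
      obtain ⟨d, rfl⟩ : ∃ d, m = j + 1 + d := ⟨m - (j + 1), by omega⟩
      rw [show 2 * (j + 1 + d) - 2 * j = 2 * (d + 1) by omega] at h1
      rw [show 2 * (j + 1 + d) - (2 * j + 1) = 2 * d + 1 by omega] at h2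
      rw [show j + 1 + d - j = d + 1 by omega] at h3
      rw [show 2 * (j + 1) = 2 * j + 1 + 1 by ring]
      set m := j + 1 + d with hm
      have key : (2 * m).choose (2 * j + 1 + 1) * ((2 * j + 1) * (j + 1))
          = (2 * m).choose (2 * j) * ((2 * d + 1) * (d + 1)) := by
        have : (2 * m).choose (2 * j + 1 + 1) * ((2 * j + 1) * (j + 1)) * 2
          = (2 * m).choose (2 * j) * ((2 * d + 1) * (d + 1)) * 2 := by
          calc _ = ((2 * m).choose (2 * j + 1 + 1) * (2 * j + 1 + 1)) * (2 * j + 1) := by ring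
            _ = ((2 * m).choose (2 * j + 1) * (2 * j + 1)) * (2 * d + 1) := by rw [h2]; ring
            _ = _ := by rw [h1]; ring
        omega
      refine Nat.le_of_mul_le_mul_right (c := (2 * j + 1) * (j + 1)) ?_ (by positivity)
      calc _ = (2 * m).choose (2 * j) * ((2 * d + 1) * (d + 1)) := key
        _ ≤ (m.choose j * (2 * m) ^ j) * ((2 * m * (2 * j + 1)) * (d + 1)) := by
          refine Nat.mul_le_mul ih (Nat.mul_le_mul_right _ ?_)
          have : 2 * m * 1 ≤ 2 * m * (2 * j + 1) := Nat.mul_le_mul_left _ (by omega)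
          omega
        _ = (m.choose j * (d + 1)) * (2 * m) ^ (j + 1) * (2 * j + 1) := by ring
        _ = _ := by rw [← h3]; ring
    · rw [Nat.choose_eq_zero_of_lt (by omega)]
      simp

theorem two_point_pow_le (x y : ℝ) (m : ℕ) :
    (x + y) ^ (2 * m) + (x - y) ^ (2 * m) ≤ 2 * (x ^ 2 + 2 * m * y ^ 2) ^ m := by
  have h : (x + y) ^ (2 * m) + (x - y) ^ (2 * m)
      = 2 * ∑ j ∈ range (m + 1), y ^ (2 * j) * x ^ (2 * m - 2 * j) * (2 * m).choose (2 * j) := by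
    rw [add_comm x y, show x - y = -y + x by ring, add_pow, add_pow, ← sum_add_distrib]
    have hz : ∀ N : ℕ, ∀ g : ℕ → ℝ,
        ∑ i ∈ range (2 * N + 1), (g i + (-1) ^ i * g i) = 2 * ∑ j ∈ range (N + 1), g (2 * j) := by
      intro N g
      induction N with
      | zero => simp; ring
      | succ N ih =>
        rw [show 2 * (N + 1) + 1 = 2 * N + 1 + 1 + 1 by ring, sum_range_succ, sum_range_succ, ih,
          sum_range_succ _ (N + 1), mul_add]
        have e1 : (-1 : ℝ) ^ (2 * N + 1) = -1 := Odd.neg_one_pow ⟨N, rfl⟩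
        have e2 : (-1 : ℝ) ^ (2 * N + 1 + 1) = 1 := Even.neg_one_pow ⟨N + 1, by ring⟩
        rw [e1, e2, show 2 * (N + 1) = 2 * N + 1 + 1 by ring]
        ring
    rw [← hz m (fun i => y ^ i * x ^ (2 * m - i) * (2 * m).choose i)]
    refine sum_congr rfl fun i _ => ?_
    rw [neg_pow y i]; ring
  rw [h, add_comm (x ^ 2), add_pow]
  refine mul_le_mul_of_nonneg_left (sum_le_sum fun j hj => ?_) (by norm_num)
  have hc : (((2 * m).choose (2 * j) : ℕ) : ℝ) ≤ m.choose j * (2 * m) ^ j := by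
    exact_mod_cast choose_two_mul_le m j
  rw [← Nat.mul_sub, pow_mul, pow_mul x, mul_pow]
  calc _ ≤ (y ^ 2) ^ j * (x ^ 2) ^ (m - j) * (m.choose j * (2 * m) ^ j) := by gcongr
    _ = _ := by ring

theorem sum_add_pow_le {ι : Type*} (s : Finset ι) {X Y : ι → ℝ} {A B N : ℝ} {m : ℕ} (hm : m ≠ 0)
    (hX : ∀ i ∈ s, 0 ≤ X i) (hY : ∀ i ∈ s, 0 ≤ Y i) (hA : 0 ≤ A) (hB : 0 ≤ B) (hN : 0 ≤ N)
    (hXA : ∑ i ∈ s, X i ^ m ≤ N * A ^ m) (hYB : ∑ i ∈ s, Y i ^ m ≤ N * B ^ m) :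
    ∑ i ∈ s, (X i + Y i) ^ m ≤ N * (A + B) ^ m := by
  have hm' : (m : ℝ) ≠ 0 := by exact_mod_cast hm
  have h1 : (1 : ℝ) ≤ m := by exact_mod_cast Nat.one_le_iff_ne_zero.2 hm
  have key := Real.Lp_add_le_of_nonneg (s := s) h1 hX hY
  simp only [Real.rpow_natCast] at key
  have root : ∀ {T D : ℝ}, 0 ≤ D → T ≤ N * D ^ m → 0 ≤ T →
      T ^ (1 / (m : ℝ)) ≤ N ^ (1 / (m : ℝ)) * D := by
    intro T D hD hT hT0
    calc T ^ (1 / (m : ℝ)) ≤ (N * D ^ m) ^ (1 / (m : ℝ)) := by gcongr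
      _ = _ := by
        rw [Real.mul_rpow hN (by positivity), one_div, Real.pow_rpow_inv_natCast hD hm]
  have hs0 : 0 ≤ ∑ i ∈ s, (X i + Y i) ^ m :=
    sum_nonneg fun i hi => pow_nonneg (add_nonneg (hX i hi) (hY i hi)) _
  have := key.trans (add_le_add
    (root hA hXA (sum_nonneg fun i hi => pow_nonneg (hX i hi) _))
    (root hB hYB (sum_nonneg fun i hi => pow_nonneg (hY i hi) _)))
  rw [← mul_add] at this
  have h2 := pow_le_pow_left₀ (by positivity) this m
  rwa [mul_pow, one_div, Real.rpow_inv_natCast_pow hs0 hm, Real.rpow_inv_natCast_pow hN hm] at h2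

/-- The Walsh character of `S` at the sign pattern which is `-1` exactly on `C`. -/
def walsh {α : Type*} [DecidableEq α] (S C : Finset α) : ℝ := ∏ w ∈ S, if w ∈ C then -1 else 1

theorem walsh_insert_right {α : Type*} [DecidableEq α] {S C : Finset α} {a : α} (ha : a ∉ S) :
    walsh S (insert a C) = walsh S C := by
  refine prod_congr rfl fun w hw => ?_
  have : w ≠ a := fun h => ha (h ▸ hw)
  simp [this]

/-- Hypercontractivity of the noise operator on the discrete cube, from `L²` to `L^(2m)`. -/
theorem sum_walsh_pow_le {α : Type*} [DecidableEq α] {m : ℕ} (hm : m ≠ 0) (s : Finset α) :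
    ∀ f : Finset α → ℝ, ∑ C ∈ s.powerset, (∑ S ∈ s.powerset, f S * walsh S C) ^ (2 * m)
      ≤ 2 ^ #s * (∑ S ∈ s.powerset, (2 * m) ^ #S * f S ^ 2) ^ m := by
  induction s using Finset.induction_on with
  | empty => intro f; simp [walsh, pow_mul]
  | insert a s ha ih =>
    intro f
    have mem : ∀ {T}, T ∈ s.powerset → a ∉ T := fun hT h => ha (mem_powerset.1 hT h)
    set g₀ : Finset α → ℝ := fun C => ∑ S ∈ s.powerset, f S * walsh S C
    set g₁ : Finset α → ℝ := fun C => ∑ S ∈ s.powerset, f (insert a S) * walsh S C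
    have e₀ : ∀ C ∈ s.powerset,
        ∑ S ∈ (insert a s).powerset, f S * walsh S C = g₀ C + g₁ C := by
      intro C hC
      rw [sum_powerset_insert ha]
      congr 1
      refine sum_congr rfl fun S hS => ?_
      simp [walsh, prod_insert (mem hS), mem hC]
    have e₁ : ∀ C ∈ s.powerset,
        ∑ S ∈ (insert a s).powerset, f S * walsh S (insert a C) = g₀ C - g₁ C := by
      intro C hC
      rw [sum_powerset_insert ha, sub_eq_add_neg, ← sum_neg_distrib]
      congr 1
      · exact sum_congr rfl fun S hS => by rw [walsh_insert_right (mem hS)]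
      · refine sum_congr rfl fun S hS => ?_
        rw [← walsh_insert_right (mem hS) (C := C)]
        simp [walsh, prod_insert (mem hS)]
    have hw : ∑ S ∈ (insert a s).powerset, (2 * (m : ℝ)) ^ #S * f S ^ 2
        = (∑ S ∈ s.powerset, (2 * (m : ℝ)) ^ #S * f S ^ 2)
          + (2 * (m : ℝ)) * (∑ S ∈ s.powerset, (2 * (m : ℝ)) ^ #S * f (insert a S) ^ 2) := by
      rw [sum_powerset_insert ha, mul_sum]
      congr 1
      refine sum_congr rfl fun S hS => ?_
      rw [card_insert_of_notMem (mem hS)]; ring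
    rw [sum_powerset_insert ha, ← sum_add_distrib, hw, card_insert_of_notMem ha]
    have h0 := ih f
    have h1 := ih (fun S => f (insert a S))
    set A := ∑ S ∈ s.powerset, (2 * (m : ℝ)) ^ #S * f S ^ 2
    set B := ∑ S ∈ s.powerset, (2 * (m : ℝ)) ^ #S * f (insert a S) ^ 2
    calc _ ≤ ∑ C ∈ s.powerset, 2 * (g₀ C ^ 2 + 2 * m * g₁ C ^ 2) ^ m := by
          refine sum_le_sum fun C hC => ?_
          rw [e₀ C hC, e₁ C hC]
          exact two_point_pow_le _ _ _
      _ = 2 * ∑ C ∈ s.powerset, (g₀ C ^ 2 + 2 * m * g₁ C ^ 2) ^ m := by rw [mul_sum]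
      _ ≤ 2 * (2 ^ #s * (A + 2 * m * B) ^ m) := by
          refine mul_le_mul_of_nonneg_left ?_ (by norm_num)
          refine sum_add_pow_le _ hm (fun _ _ => by positivity) (fun _ _ => by positivity)
            (sum_nonneg fun _ _ => by positivity)
            (mul_nonneg (by positivity) (sum_nonneg fun _ _ => by positivity)) (by positivity) ?_ ?_
          · simpa only [← pow_mul] using h0
          · simp only [mul_pow _ (_ ^ 2), ← pow_mul, ← mul_sum]
            rw [mul_pow _ B, mul_left_comm]
            exact mul_le_mul_of_nonneg_left h1 (by positivity)
      _ = _ := by ring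

variable {n : ℕ}

theorem IsMatching.eq_of_fst {M : Finset (Fin n × Fin n)} (hM : IsMatching M) {e e' : Fin n × Fin n}
    (he : e ∈ M) (he' : e' ∈ M) (h : e.1 = e'.1) : e = e' :=
  by_contra fun hne => (hM e he e' he' hne).1 h

theorem IsMatching.eq_of_snd {M : Finset (Fin n × Fin n)} (hM : IsMatching M) {e e' : Fin n × Fin n}
    (he : e ∈ M) (he' : e' ∈ M) (h : e.2 = e'.2) : e = e' :=
  by_contra fun hne => (hM e he e' he' hne).2 h

theorem IsMatching.mono {M K : Finset (Fin n × Fin n)} (hM : IsMatching M) (hK : K ⊆ M) :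
    IsMatching K :=
  fun e he f hf => hM e (hK he) f (hK hf)

/-- The set of endpoints of a set of edges. -/
def endpoints (K : Finset (Fin n × Fin n)) : Finset (Fin n ⊕ Fin n) :=
  (K.image Prod.fst).disjSum (K.image Prod.snd)

/-- The graph of all edges that are monochromatic for the two-colouring with colour class `C`. -/
def colorGraph (C : Finset (Fin n ⊕ Fin n)) (e : Fin n × Fin n) : Bool :=
  decide (Sum.inl e.1 ∈ C ↔ Sum.inr e.2 ∈ C)

theorem IsMatching.card_image_fst {K : Finset (Fin n × Fin n)} (hK : IsMatching K) :
    #(K.image Prod.fst) = #K :=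
  card_image_of_injOn fun _ he _ he' h => hK.eq_of_fst he he' h

theorem IsMatching.card_image_snd {K : Finset (Fin n × Fin n)} (hK : IsMatching K) :
    #(K.image Prod.snd) = #K :=
  card_image_of_injOn fun _ he _ he' h => hK.eq_of_snd he he' h

theorem IsMatching.card_endpoints {K : Finset (Fin n × Fin n)} (hK : IsMatching K) :
    #(endpoints K) = 2 * #K := by
  rw [endpoints, card_disjSum, hK.card_image_fst, hK.card_image_snd, two_mul]

theorem IsMatching.walsh_endpoints {K : Finset (Fin n × Fin n)} (hK : IsMatching K)
    (C : Finset (Fin n ⊕ Fin n)) :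
    walsh (endpoints K) C = ∏ e ∈ K, if colorGraph C e then 1 else -1 := by
  rw [walsh, endpoints, prod_disjSum, prod_image fun _ he _ he' h => hK.eq_of_fst he he' h,
    prod_image fun _ he _ he' h => hK.eq_of_snd he he' h, ← prod_mul_distrib]
  refine prod_congr rfl fun e _ => ?_
  by_cases h1 : Sum.inl e.1 ∈ C <;> by_cases h2 : Sum.inr e.2 ∈ C <;> simp [colorGraph, h1, h2]

/-- A matching with `t` edges has the same endpoints as at most `t!` matchings. -/
theorem card_matching_endpoints_le [DecidablePred (IsMatching (n := n))]
    {K : Finset (Fin n × Fin n)} (hK : IsMatching K) :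
    #{K' | IsMatching K' ∧ endpoints K' = endpoints K} ≤ (#K).factorial := by
  have hcard : #(univ : Finset ((K.image Prod.fst : Finset _) ↪ (K.image Prod.snd : Finset _)))
      = (#K).factorial := by
    rw [card_univ, Fintype.card_embedding_eq, Fintype.card_coe, Fintype.card_coe,
      hK.card_image_fst, hK.card_image_snd, Nat.descFactorial_self]
  rw [← hcard]
  refine card_le_card_of_surjOn (fun φ => univ.image fun u => (u.1, (φ u).1)) ?_
  intro K' hK'
  simp only [coe_filter, mem_univ, true_and, Set.mem_ofPred_eq] at hK'
  obtain ⟨hm, hv⟩ := hK'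
  have hfst : K'.image Prod.fst = K.image Prod.fst := by
    ext u
    have := Finset.ext_iff.1 hv (Sum.inl u)
    simpa only [endpoints, inl_mem_disjSum] using this
  have hsnd : K'.image Prod.snd = K.image Prod.snd := by
    ext u
    have := Finset.ext_iff.1 hv (Sum.inr u)
    simpa only [endpoints, inr_mem_disjSum] using this
  have hex : ∀ u : (K.image Prod.fst : Finset _), ∃ v : (K.image Prod.snd : Finset _),
      (u.1, v.1) ∈ K' := by
    rintro ⟨u, hu⟩
    rw [← hfst, mem_image] at hu
    obtain ⟨e, he, rfl⟩ := hu
    exact ⟨⟨e.2, hsnd ▸ mem_image_of_mem _ he⟩, he⟩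
  choose φ hφ using hex
  refine ⟨⟨φ, fun u u' h => ?_⟩, mem_coe.2 (mem_univ _), ?_⟩
  · exact Subtype.ext (congrArg Prod.fst (hm.eq_of_snd (hφ u) (hφ u') (by simp [h])))
  · ext e
    simp only [mem_image, mem_univ, true_and]
    constructor
    · rintro ⟨u, rfl⟩
      exact hφ u
    · intro he
      have hu : e.1 ∈ K.image Prod.fst := hfst ▸ mem_image_of_mem _ he
      exact ⟨⟨e.1, hu⟩, hm.eq_of_fst (hφ ⟨e.1, hu⟩) he rfl⟩

theorem sum_factorial_mul_pow_le {α : Type*} [DecidableEq α] (M : Finset α) {k : ℕ} (hM : #M ≤ k)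
    {z : ℝ} (hz : 0 ≤ z) (hkz : k * z ≤ 1 / 2) :
    ∑ K ∈ M.powerset.erase ∅, (#K).factorial * z ^ #K ≤ 2 * (k * z) := by
  have h0 : ∑ K ∈ M.powerset, ((#K).factorial : ℝ) * z ^ #K
      = ∑ K ∈ M.powerset.erase ∅, (#K).factorial * z ^ #K + 1 := by
    rw [← sum_erase_add _ _ (empty_mem_powerset M)]; simp
  have h1 := sum_powerset_apply_card (fun t => (t.factorial : ℝ) * z ^ t) (x := M)
  rw [h0, sum_range_succ'] at h1
  have hq : 0 ≤ k * z := by positivity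
  have h2 : ∀ t, (#M).choose t • ((t.factorial : ℝ) * z ^ t) ≤ (k * z) ^ t := by
    intro t
    rw [nsmul_eq_mul, ← mul_assoc, mul_pow]
    gcongr
    have : (#M).choose t * t.factorial ≤ k ^ t := by
      rw [mul_comm, ← Nat.descFactorial_eq_factorial_mul_choose]
      exact (Nat.descFactorial_le_pow _ _).trans (Nat.pow_le_pow_left hM t)
    exact_mod_cast this
  have h3 : ∀ N, ∑ t ∈ range N, (k * z) ^ t ≤ 2 := by
    intro N
    calc _ ≤ ∑ t ∈ range N, (1 / 2 : ℝ) ^ t := by gcongr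
      _ ≤ 2 := sum_geometric_two_le N
  have h4 : ∑ t ∈ range #M, (#M).choose (t + 1) • (((t + 1).factorial : ℝ) * z ^ (t + 1))
      ≤ k * z * 2 :=
    calc _ ≤ ∑ t ∈ range #M, (k * z) ^ (t + 1) := sum_le_sum fun t _ => h2 (t + 1)
      _ = k * z * ∑ t ∈ range #M, (k * z) ^ t := by
        rw [mul_sum]; exact sum_congr rfl fun t _ => by ring
      _ ≤ _ := by gcongr; exact h3 _
  simp at h1
  simp at h4
  linarith

/-- The Walsh coefficients of the normalised number of members of `F` contained in a random
`colorGraph`, apart from the constant one. -/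
noncomputable def walshCoeff (F : Finset (Finset (Fin n × Fin n))) (S : Finset (Fin n ⊕ Fin n)) :
    ℝ :=
  (∑ M ∈ F, ∑ K ∈ M.powerset.erase ∅, if endpoints K = S then 1 else 0) / #F

theorem sum_walshCoeff_mul (F : Finset (Finset (Fin n × Fin n))) (g : Finset (Fin n ⊕ Fin n) → ℝ) :
    ∑ S, walshCoeff F S * g S
      = (∑ M ∈ F, ∑ K ∈ M.powerset.erase ∅, g (endpoints K)) / #F := by
  simp only [walshCoeff, div_mul_eq_mul_div, ← sum_div, sum_mul]
  congr 1
  rw [sum_comm]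
  refine sum_congr rfl fun M _ => ?_
  rw [sum_comm]
  exact sum_congr rfl fun K _ => by simp

theorem walshCoeff_endpoints_le {r : ℕ} (hr : 0 < r) {F : Finset (Finset (Fin n × Fin n))}
    (hF : F.Nonempty) (hmatch : ∀ M ∈ F, IsMatching M)
    (hspread : ∀ K, #{M ∈ F | K ⊆ M} * r ^ #K ≤ #F) {K : Finset (Fin n × Fin n)}
    (hK : IsMatching K) :
    walshCoeff F (endpoints K) ≤ (#K).factorial * (1 / (r : ℝ)) ^ #K := by
  classical
  have hF0 : (0 : ℝ) < #F := by exact_mod_cast hF.card_pos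
  have hr0 : (0 : ℝ) < r := by exact_mod_cast hr
  set T : Finset (Finset (Fin n × Fin n)) := {K' | IsMatching K' ∧ endpoints K' = endpoints K}
  rw [walshCoeff, div_le_iff₀ hF0]
  calc _ ≤ ∑ M ∈ F, ∑ K' ∈ T, if K' ⊆ M then (1 : ℝ) else 0 := by
        refine sum_le_sum fun M hM => ?_
        rw [← sum_filter, ← sum_filter]
        refine sum_le_sum_of_subset_of_nonneg ?_ fun _ _ _ => zero_le_one
        intro K' hK'
        simp only [mem_filter, mem_erase, mem_powerset] at hK'
        simp only [T, mem_filter, mem_univ, true_and]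
        exact ⟨⟨(hmatch M hM).mono hK'.1.2, hK'.2⟩, hK'.1.2⟩
    _ = ∑ K' ∈ T, (#{M ∈ F | K' ⊆ M} : ℝ) := by
        rw [sum_comm]; simp
    _ ≤ ∑ K' ∈ T, (1 / (r : ℝ)) ^ #K * #F := by
        refine sum_le_sum fun K' hK' => ?_
        simp only [T, mem_filter, mem_univ, true_and] at hK'
        have hc : #K' = #K := by
          have := congrArg card hK'.2
          rw [hK'.1.card_endpoints, hK.card_endpoints] at this
          omega
        have h : (#{M ∈ F | K' ⊆ M} : ℝ) * (r : ℝ) ^ #K ≤ #F := by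
          rw [← hc]; exact_mod_cast hspread K'
        rw [one_div, inv_pow, inv_mul_eq_div, le_div_iff₀ (by positivity)]
        exact h
    _ = #T * ((1 / (r : ℝ)) ^ #K * #F) := by rw [sum_const, nsmul_eq_mul]
    _ ≤ (#K).factorial * ((1 / (r : ℝ)) ^ #K * #F) := by
        gcongr
        exact card_matching_endpoints_le hK
    _ = _ := by ring

/-- A spread family of matchings has a member inside all but a tiny fraction of the graphs
`colorGraph C`. -/
theorem card_colorGraph_avoiding_le {k r m : ℕ} (hm : m ≠ 0) (hr : 0 < r)
    (hkr : 32 * k * m ^ 2 ≤ r) {F : Finset (Finset (Fin n × Fin n))} (hF : F.Nonempty)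
    (hmatch : ∀ M ∈ F, IsMatching M) (hcard : ∀ M ∈ F, #M ≤ k)
    (hspread : ∀ K, #{M ∈ F | K ⊆ M} * r ^ #K ≤ #F) :
    #{C : Finset (Fin n ⊕ Fin n) | ¬ ∃ M ∈ F, ∀ e ∈ M, colorGraph C e = true} * 4 ^ m
      ≤ 4 ^ n := by
  have hF0 : (0 : ℝ) < #F := by exact_mod_cast hF.card_pos
  have hr0 : (0 : ℝ) < r := by exact_mod_cast hr
  set z : ℝ := (2 * m) ^ 2 * (1 / r) with hz
  have hkz : k * z ≤ 1 / 8 := by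
    have : (32 * k * m ^ 2 : ℝ) ≤ r := by exact_mod_cast hkr
    rw [hz, mul_one_div, mul_div_assoc', div_le_iff₀ hr0]
    linarith
  have hW : ∑ S : Finset (Fin n ⊕ Fin n), (2 * (m : ℝ)) ^ #S * walshCoeff F S ^ 2 ≤ 1 / 4 := by
    calc _ = ∑ S, walshCoeff F S * ((2 * (m : ℝ)) ^ #S * walshCoeff F S) :=
          sum_congr rfl fun S _ => by ring
      _ = (∑ M ∈ F, ∑ K ∈ M.powerset.erase ∅,
            (2 * (m : ℝ)) ^ #(endpoints K) * walshCoeff F (endpoints K)) / #F :=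
          sum_walshCoeff_mul F _
      _ ≤ (∑ M ∈ F, ∑ K ∈ M.powerset.erase ∅, (#K).factorial * z ^ #K) / #F := by
          refine div_le_div_of_nonneg_right
            (sum_le_sum fun M hM => sum_le_sum fun K hK => ?_) hF0.le
          have hKm : IsMatching K := (hmatch M hM).mono (mem_powerset.1 (mem_of_mem_erase hK))
          rw [hKm.card_endpoints, pow_mul, hz, mul_pow _ (1 / (r : ℝ)), mul_left_comm]
          gcongr
          exact walshCoeff_endpoints_le hr hF hmatch hspread hKm
      _ ≤ (∑ M ∈ F, (1 / 4 : ℝ)) / #F := by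
          gcongr with M hM
          have := sum_factorial_mul_pow_le M (hcard M hM) (z := z) (by positivity) (by linarith)
          linarith
      _ = 1 / 4 := by
          rw [sum_const, nsmul_eq_mul]; field_simp
  have hyp := sum_walsh_pow_le hm (univ : Finset (Fin n ⊕ Fin n)) (walshCoeff F)
  rw [powerset_univ] at hyp
  set B : Finset (Finset (Fin n ⊕ Fin n)) := {C | ¬ ∃ M ∈ F, ∀ e ∈ M, colorGraph C e = true}
  have hB : ∀ C ∈ B, (∑ S, walshCoeff F S * walsh S C) ^ (2 * m) = 1 := by
    intro C hC
    simp only [B, mem_filter, mem_univ, true_and] at hC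
    have : ∑ S, walshCoeff F S * walsh S C = -1 := by
      rw [sum_walshCoeff_mul F (fun S => walsh S C), div_eq_iff hF0.ne']
      have : ∀ M ∈ F, ∑ K ∈ M.powerset.erase ∅, walsh (endpoints K) C = -1 := by
        intro M hM
        have h1 : ∏ e ∈ M, (1 + if colorGraph C e then (1 : ℝ) else -1) = 0 := by
          have : ∃ e ∈ M, ¬ colorGraph C e = true := by
            by_contra! h
            exact hC ⟨M, hM, h⟩
          obtain ⟨e, he, hne⟩ := this
          exact prod_eq_zero he (by simp [hne])
        rw [prod_one_add, ← sum_erase_add _ _ (empty_mem_powerset M)] at h1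
        simp only [prod_empty] at h1
        rw [eq_neg_of_add_eq_zero_left h1 |>.symm]
        refine sum_congr rfl fun K hK => ?_
        exact ((hmatch M hM).mono (mem_powerset.1 (mem_of_mem_erase hK))).walsh_endpoints C
      rw [sum_congr rfl this]
      simp
    rw [this, pow_mul]; norm_num
  have hBle : (#B : ℝ) ≤ 4 ^ n * (1 / 4) ^ m :=
    calc (#B : ℝ) = ∑ C ∈ B, (∑ S, walshCoeff F S * walsh S C) ^ (2 * m) := by
          rw [sum_congr rfl hB]; simp
      _ ≤ ∑ C, (∑ S, walshCoeff F S * walsh S C) ^ (2 * m) :=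
          sum_le_sum_of_subset_of_nonneg (subset_univ _)
            fun _ _ _ => (even_two_mul m).pow_nonneg _
      _ ≤ _ := hyp
      _ ≤ 2 ^ (2 * n) * (1 / 4) ^ m := by
          have h2 : #(univ : Finset (Fin n ⊕ Fin n)) = 2 * n := by simp [two_mul]
          rw [h2]
          gcongr
      _ = _ := by rw [pow_mul]; norm_num
  have : (#B : ℝ) * 4 ^ m ≤ 4 ^ n := by
    rw [one_div, inv_pow, ← div_eq_mul_inv, le_div_iff₀ (by positivity)] at hBle
    exact hBle
  exact_mod_cast this

/-- The disjunction of conjunctions of edges described by a family of edge sets. -/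
def Accepts (A : Finset (Finset (Fin n × Fin n))) (x : Fin n × Fin n → Bool) : Prop :=
  ∃ M ∈ A, ∀ e ∈ M, x e = true

open Classical in
/-- A family of matchings of size at most `k` is closed when it contains every such matching `K`
that it approximately implies on the graphs `colorGraph C`, up to a fraction `4⁻ᵐ` of them. -/
structure IsClosedFamily (k m : ℕ) (A : Finset (Finset (Fin n × Fin n))) : Prop where
  isMatching : ∀ M ∈ A, IsMatching M
  card_le : ∀ M ∈ A, #M ≤ k
  mem_of_implied : ∀ K, IsMatching K → #K ≤ k →
    #{C : Finset (Fin n ⊕ Fin n) |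
      (∀ e ∈ K, colorGraph C e = true) ∧ ¬ Accepts A (colorGraph C)} * 4 ^ m ≤ 4 ^ n → K ∈ A

theorem IsClosedFamily.inter {k m : ℕ} {A B : Finset (Finset (Fin n × Fin n))}
    (hA : IsClosedFamily k m A) (hB : IsClosedFamily k m B) : IsClosedFamily k m (A ∩ B) where
  isMatching M hM := hA.isMatching M (mem_of_mem_inter_left hM)
  card_le M hM := hA.card_le M (mem_of_mem_inter_left hM)
  mem_of_implied K hK hk h := by
    refine mem_inter.2 ⟨hA.mem_of_implied K hK hk (le_trans ?_ h),
      hB.mem_of_implied K hK hk (le_trans ?_ h)⟩ <;>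
    · refine Nat.mul_le_mul_right _ (card_le_card fun C hC => ?_)
      simp only [mem_filter, mem_univ, true_and] at hC ⊢
      refine ⟨hC.1, fun ⟨M, hM, h⟩ => hC.2 ⟨M, ?_, h⟩⟩
      first
        | exact mem_of_mem_inter_left hM
        | exact mem_of_mem_inter_right hM

theorem IsClosedFamily.mem_of_subset {k m : ℕ} {A : Finset (Finset (Fin n × Fin n))}
    (hA : IsClosedFamily k m A) {M K : Finset (Fin n × Fin n)} (hM : M ∈ A) (hMK : M ⊆ K)
    (hK : IsMatching K) (hk : #K ≤ k) : K ∈ A := by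
  classical
  refine hA.mem_of_implied K hK hk ?_
  rw [filter_false_of_mem, card_empty, zero_mul]
  · exact Nat.zero_le _
  · exact fun C _ h => h.2 ⟨M, hM, fun e he => h.1 e (hMK he)⟩

open Classical in
/-- Every family of small matchings extends to a closed one that accepts few further graphs
`colorGraph C`. -/
theorem exists_isClosedFamily (k m : ℕ) (A : Finset (Finset (Fin n × Fin n)))
    (hA : ∀ M ∈ A, IsMatching M ∧ #M ≤ k) :
    ∃ B, A ⊆ B ∧ IsClosedFamily k m B ∧
      #{C : Finset (Fin n ⊕ Fin n) | Accepts B (colorGraph C) ∧ ¬ Accepts A (colorGraph C)} * 4 ^ m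
        ≤ #(({M | IsMatching M ∧ #M ≤ k} : Finset (Finset (Fin n × Fin n))) \ A) * 4 ^ n := by
  induction hd : #(({M | IsMatching M ∧ #M ≤ k} : Finset (Finset (Fin n × Fin n))) \ A)
    generalizing A with
  | zero =>
    refine ⟨A, Subset.rfl, ⟨fun M hM => (hA M hM).1, fun M hM => (hA M hM).2, ?_⟩, by simp⟩
    intro K hK hk _
    by_contra hKA
    exact notMem_empty K (card_eq_zero.1 hd ▸ by simp [hK, hk, hKA])
  | succ d ih =>
    by_cases hcl : IsClosedFamily k m A
    · exact ⟨A, Subset.rfl, hcl, by simp⟩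
    · have : ∃ K, IsMatching K ∧ #K ≤ k ∧
          #{C : Finset (Fin n ⊕ Fin n) |
            (∀ e ∈ K, colorGraph C e = true) ∧ ¬ Accepts A (colorGraph C)} * 4 ^ m ≤ 4 ^ n ∧
          K ∉ A := by
        by_contra! h
        exact hcl ⟨fun M hM => (hA M hM).1, fun M hM => (hA M hM).2, h⟩
      obtain ⟨K, hK, hk, himp, hKA⟩ := this
      obtain ⟨B, hAB, hB, herr⟩ := ih (insert K A)
        (fun M hM => (mem_insert.1 hM).elim (fun h => h ▸ ⟨hK, hk⟩) (hA M)) (by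
          rw [sdiff_insert, card_erase_of_mem, hd]
          · rfl
          · simp [hK, hk, hKA])
      refine ⟨B, (subset_insert K A).trans hAB, hB, ?_⟩
      have hsub : ({C | Accepts B (colorGraph C) ∧ ¬ Accepts A (colorGraph C)} :
          Finset (Finset (Fin n ⊕ Fin n)))
          ⊆ univ.filter (fun C => Accepts B (colorGraph C) ∧
              ¬ Accepts (insert K A) (colorGraph C)) ∪
            univ.filter fun C => (∀ e ∈ K, colorGraph C e = true) ∧ ¬ Accepts A (colorGraph C) := by
        intro C hC
        simp only [mem_union, mem_filter, mem_univ, true_and] at hC ⊢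
        by_cases h : ∀ e ∈ K, colorGraph C e = true
        · exact Or.inr ⟨h, hC.2⟩
        · refine Or.inl ⟨hC.1, ?_⟩
          rintro ⟨M, hM, hMC⟩
          rcases mem_insert.1 hM with rfl | hM
          · exact h hMC
          · exact hC.2 ⟨M, hM, hMC⟩
      have := Nat.mul_le_mul_right (4 ^ m) ((card_le_card hsub).trans (card_union_le _ _))
      rw [add_mul] at this
      calc _ ≤ _ := this
        _ ≤ d * 4 ^ n + 4 ^ n := Nat.add_le_add herr himp
        _ = _ := by ring

open Classical in
/-- A sunflower-type bound: a closed family has few minimal members of each size. -/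
theorem IsClosedFamily.card_minimal_le {k m r : ℕ} (hm : m ≠ 0) (hr : 0 < r)
    (hkr : 32 * k * m ^ 2 ≤ r) {A : Finset (Finset (Fin n × Fin n))} (hA : IsClosedFamily k m A)
    (l : ℕ) : #{M ∈ A | Minimal (· ∈ A) M ∧ #M = l} ≤ r ^ l := by
  set F : Finset (Finset (Fin n × Fin n)) := {M ∈ A | Minimal (· ∈ A) M ∧ #M = l} with hFdef
  have hFmem : ∀ {M}, M ∈ F → Minimal (· ∈ A) M ∧ #M = l := fun h => (mem_filter.1 h).2
  by_contra! hlt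
  obtain ⟨K, hK, hmax⟩ := exists_max_image
    ({K | r ^ l < #{M ∈ F | K ⊆ M} * r ^ #K} : Finset (Finset (Fin n × Fin n))) card
    ⟨∅, by simpa using hlt⟩
  simp only [mem_filter, mem_univ, true_and] at hK hmax
  have hne : ({M ∈ F | K ⊆ M}).Nonempty := by
    rw [nonempty_iff_ne_empty]
    intro h
    simp [h] at hK
  obtain ⟨M₀, hM₀⟩ := hne
  obtain ⟨hM₀F, hKM₀⟩ := mem_filter.1 hM₀
  have hKl : #K < l := by
    refine lt_of_le_of_ne ((card_le_card hKM₀).trans (hFmem hM₀F).2.le) fun h => ?_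
    have : ({M ∈ F | K ⊆ M} : Finset _) ⊆ {K} := by
      intro M hM
      obtain ⟨hMF, hKM⟩ := mem_filter.1 hM
      exact mem_singleton.2 (eq_of_subset_of_card_le hKM (by rw [(hFmem hMF).2, h])).symm
    have := card_le_card this
    rw [card_singleton] at this
    rw [h] at hK
    exact absurd hK (not_lt.2 (by simpa using Nat.mul_le_mul_right (r ^ l) this))
  have hM₀A : M₀ ∈ A := (hFmem hM₀F).1.prop
  have hKmatch : IsMatching K := (hA.isMatching M₀ hM₀A).mono hKM₀
  have hKk : #K ≤ k := (card_le_card hKM₀).trans (hA.card_le M₀ hM₀A)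
  set G : Finset (Finset (Fin n × Fin n)) := ({M ∈ F | K ⊆ M} : Finset _).image (· \ K) with hG
  have hinj : Set.InjOn (· \ K) (({M ∈ F | K ⊆ M} : Finset _) : Set (Finset (Fin n × Fin n))) := by
    intro M hM M' hM' h
    have h1 := (mem_filter.1 hM).2
    have h2 := (mem_filter.1 hM').2
    rw [← sdiff_union_of_subset h1, ← sdiff_union_of_subset h2]
    exact congrArg (· ∪ K) h
  have hGcard : #G = #{M ∈ F | K ⊆ M} := card_image_of_injOn hinj
  have hGmem : ∀ {M'}, M' ∈ G → ∃ M ∈ A, K ⊆ M ∧ M' = M \ K := by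
    intro M' hM'
    obtain ⟨M, hM, rfl⟩ := mem_image.1 hM'
    obtain ⟨hMF, hKM⟩ := mem_filter.1 hM
    exact ⟨M, (hFmem hMF).1.prop, hKM, rfl⟩
  have hspread : ∀ K', #{M ∈ G | K' ⊆ M} * r ^ #K' ≤ #G := by
    intro K'
    rcases K'.eq_empty_or_nonempty with rfl | hK'
    · simp
    by_cases hd : Disjoint K K'
    · have hsub : ({M ∈ G | K' ⊆ M} : Finset _) ⊆
          ({M ∈ F | K ∪ K' ⊆ M} : Finset _).image (· \ K) := by
        intro M' hM'
        obtain ⟨hM'G, hK'M'⟩ := mem_filter.1 hM'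
        obtain ⟨M, hM, rfl⟩ := mem_image.1 hM'G
        obtain ⟨hMF, hKM⟩ := mem_filter.1 hM
        exact mem_image.2 ⟨M, mem_filter.2
          ⟨hMF, union_subset hKM (hK'M'.trans sdiff_subset)⟩, rfl⟩
      have h1 := (card_le_card hsub).trans card_image_le
      have h2 : #{M ∈ F | K ∪ K' ⊆ M} * r ^ #(K ∪ K') ≤ r ^ l := by
        by_contra! h
        have := hmax _ h
        rw [card_union_of_disjoint hd] at this
        have := hK'.card_pos
        omega
      rw [card_union_of_disjoint hd, pow_add] at h2
      rw [hGcard]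
      refine Nat.le_of_mul_le_mul_right (c := r ^ #K) ?_ (by positivity)
      calc _ ≤ #{M ∈ F | K ∪ K' ⊆ M} * r ^ #K' * r ^ #K := by gcongr
        _ = #{M ∈ F | K ∪ K' ⊆ M} * (r ^ #K * r ^ #K') := by ring
        _ ≤ r ^ l := h2
        _ ≤ _ := hK.le
    · rw [filter_false_of_mem, card_empty, zero_mul]
      · exact Nat.zero_le _
      · intro M' hM' hsub
        obtain ⟨M, _, _, rfl⟩ := hGmem hM'
        exact hd (disjoint_of_subset_right hsub disjoint_sdiff)
  have hbound := card_colorGraph_avoiding_le hm hr hkr (F := G)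
    (Finset.Nonempty.image ⟨M₀, hM₀⟩ _)
    (fun M' hM' => by
      obtain ⟨M, hM, _, rfl⟩ := hGmem hM'
      exact (hA.isMatching M hM).mono sdiff_subset)
    (fun M' hM' => by
      obtain ⟨M, hM, _, rfl⟩ := hGmem hM'
      exact (card_le_card sdiff_subset).trans (hA.card_le M hM))
    hspread
  have hKA : K ∈ A := by
    refine hA.mem_of_implied K hKmatch hKk
      (le_trans (Nat.mul_le_mul_right _ (card_le_card ?_)) hbound)
    intro C hC
    simp only [mem_filter, mem_univ, true_and] at hC ⊢
    rintro ⟨M', hM', hMC⟩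
    obtain ⟨M, hM, hKM, rfl⟩ := hGmem hM'
    refine hC.2 ⟨M, hM, fun e he => ?_⟩
    by_cases heK : e ∈ K
    · exact hC.1 e heK
    · exact hMC e (mem_sdiff.2 ⟨he, heK⟩)
  have := (hFmem hM₀F).1.le_of_le hKA hKM₀
  have := card_le_card this
  have := (hFmem hM₀F).2
  omega

theorem card_finset_card_le {α : Type*} [Fintype α] (k : ℕ) :
    #{M : Finset α | #M ≤ k} ≤ (Fintype.card α + 1) ^ k := by
  classical
  have hsub : ({M | #M ≤ k} : Finset (Finset α)) ⊆
      (range (k + 1)).biUnion fun i => powersetCard i univ := by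
    intro M hM
    simp only [mem_filter, mem_univ, true_and] at hM
    simp only [mem_biUnion, mem_range, mem_powersetCard, subset_univ, true_and]
    exact ⟨#M, by omega, rfl⟩
  calc _ ≤ _ := card_le_card hsub
    _ ≤ ∑ i ∈ range (k + 1), #(powersetCard i (univ : Finset α)) := card_biUnion_le
    _ ≤ ∑ i ∈ range (k + 1), Fintype.card α ^ i * 1 ^ (k - i) * k.choose i := by
        refine sum_le_sum fun i hi => ?_
        rw [card_powersetCard, card_univ, one_pow, mul_one]
        have h1 : 1 ≤ k.choose i := Nat.choose_pos (by rw [mem_range] at hi; omega)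
        calc _ ≤ Fintype.card α ^ i := Nat.choose_le_pow _ _
          _ ≤ _ := Nat.le_mul_of_pos_right _ h1
    _ = _ := (add_pow _ _ _).symm

/-- The graph of a permutation, as a perfect matching. -/
def permGraph (σ : Equiv.Perm (Fin n)) (e : Fin n × Fin n) : Bool := decide (σ e.1 = e.2)

theorem matchProp_permGraph (σ : Equiv.Perm (Fin n)) : MatchProp n (permGraph σ) := by
  refine ⟨univ.image fun u => (u, σ u), ?_, ?_, ?_⟩
  · simp only [IsMatching, mem_image, mem_univ, true_and]
    rintro _ ⟨u, rfl⟩ _ ⟨v, rfl⟩ h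
    have : u ≠ v := fun huv => h (huv ▸ rfl)
    exact ⟨this, fun h' => this (σ.injective h')⟩
  · rw [card_image_of_injective _ fun u v h => congrArg Prod.fst h, card_univ, Fintype.card_fin]
  · simp [permGraph]

/-- A matching is contained in few perfect matchings. -/
theorem card_permGraph_superset_le {M : Finset (Fin n × Fin n)} (hM : IsMatching M) {h : ℕ}
    (hh : #M + h ≤ n) :
    #{σ : Equiv.Perm (Fin n) | ∀ e ∈ M, permGraph σ e = true} * h ^ #M ≤ n.factorial := by
  induction M using Finset.induction_on with
  | empty => simp [Fintype.card_perm]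
  | insert e M he ih =>
    rw [card_insert_of_notMem he] at hh ⊢
    refine le_trans ?_ (ih (hM.mono (subset_insert e M)) (by omega))
    rw [pow_succ', ← mul_assoc]
    refine Nat.mul_le_mul_right _ ?_
    have hfree : h ≤ #(M.image Prod.snd)ᶜ := by
      rw [card_compl, Fintype.card_fin, (hM.mono (subset_insert e M)).card_image_snd]
      omega
    refine (Nat.mul_le_mul_left _ hfree).trans ?_
    rw [← card_product]
    refine card_le_card_of_injOn (fun p => p.1.trans (Equiv.swap e.2 p.2)) ?_ ?_
    · rintro ⟨σ, v⟩ hp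
      simp only [permGraph, decide_eq_true_eq, mem_insert, forall_eq_or_imp, coe_product,
        Set.mem_prod, mem_coe, mem_filter, mem_univ, true_and, mem_compl, mem_image, not_exists,
        not_and] at hp ⊢
      intro e' he'
      rw [Equiv.trans_apply, hp.1.2 e' he']
      refine Equiv.swap_apply_of_ne_of_ne ?_ (hp.2 e' he')
      intro heq
      exact he (hM.eq_of_snd (mem_insert_of_mem he') (mem_insert_self e M) heq ▸ he')
    · rintro ⟨σ, v⟩ hp ⟨τ, w⟩ hq heq
      simp only [permGraph, decide_eq_true_eq, mem_insert, forall_eq_or_imp, coe_product,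
        Set.mem_prod, mem_coe, mem_filter, mem_univ, true_and] at hp hq heq
      have h1 : v = w := by
        have := Equiv.congr_fun heq e.1
        simpa [hp.1.1, hq.1.1] using this
      subst h1
      refine Prod.ext (Equiv.ext fun u => ?_) rfl
      have := Equiv.congr_fun heq u
      simpa using this

open Classical in
theorem IsClosedFamily.card_permGraph_large_minimal_le {k m r : ℕ} (hm : m ≠ 0) (hr : 0 < r)
    (hkr : 32 * k * m ^ 2 ≤ r) (hrn : 4 * r + k ≤ n) {A : Finset (Finset (Fin n × Fin n))}
    (hA : IsClosedFamily k m A) (j : ℕ) :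
    (#{σ : Equiv.Perm (Fin n) |
      ∃ M, Minimal (· ∈ A) M ∧ j < #M ∧ ∀ e ∈ M, permGraph σ e = true} : ℝ)
      ≤ n.factorial * (1 / 4) ^ j / 3 := by
  have hsub : univ.filter (fun σ : Equiv.Perm (Fin n) =>
      ∃ M, Minimal (· ∈ A) M ∧ j < #M ∧ ∀ e ∈ M, permGraph σ e = true) ⊆
      (Ico (j + 1) (k + 1)).biUnion fun l =>
        ({M ∈ A | Minimal (· ∈ A) M ∧ #M = l} : Finset _).biUnion fun M =>
          univ.filter fun σ => ∀ e ∈ M, permGraph σ e = true := by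
    intro σ hσ
    obtain ⟨M, hM, hj, hMσ⟩ := (mem_filter.1 hσ).2
    have := hA.card_le M hM.prop
    simp only [mem_biUnion, mem_filter, mem_univ, true_and, mem_Ico]
    exact ⟨#M, by omega, M, ⟨hM.prop, hM, rfl⟩, hMσ⟩
  have hl : ∀ l ∈ Ico (j + 1) (k + 1),
      (#(({M ∈ A | Minimal (· ∈ A) M ∧ #M = l} : Finset _).biUnion fun M =>
        univ.filter fun σ : Equiv.Perm (Fin n) => ∀ e ∈ M, permGraph σ e = true) : ℝ)
      ≤ n.factorial * (1 / 4) ^ l := by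
    intro l hl
    have hlk : l ≤ k := by have := (mem_Ico.1 hl).2; omega
    have hnat : #(({M ∈ A | Minimal (· ∈ A) M ∧ #M = l} : Finset _).biUnion fun M =>
        univ.filter fun σ : Equiv.Perm (Fin n) => ∀ e ∈ M, permGraph σ e = true) * (4 * r) ^ l
        ≤ n.factorial * r ^ l := by
      calc _ ≤ (∑ M ∈ A with Minimal (· ∈ A) M ∧ #M = l,
            #{σ : Equiv.Perm (Fin n) | ∀ e ∈ M, permGraph σ e = true}) * (4 * r) ^ l :=
            Nat.mul_le_mul_right _ card_biUnion_le
        _ = ∑ M ∈ A with Minimal (· ∈ A) M ∧ #M = l,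
            #{σ : Equiv.Perm (Fin n) | ∀ e ∈ M, permGraph σ e = true} * (4 * r) ^ l := sum_mul ..
        _ ≤ ∑ M ∈ A with Minimal (· ∈ A) M ∧ #M = l, n.factorial := by
            refine sum_le_sum fun M hM => ?_
            obtain ⟨hMA, -, hMl⟩ := mem_filter.1 hM
            have := card_permGraph_superset_le (hA.isMatching M hMA) (h := 4 * r) (by omega)
            rwa [hMl] at this
        _ = #{M ∈ A | Minimal (· ∈ A) M ∧ #M = l} * n.factorial := by
            rw [sum_const, smul_eq_mul]
        _ ≤ _ := by
            rw [mul_comm]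
            exact Nat.mul_le_mul_left _ (hA.card_minimal_le hm hr hkr l)
    rw [mul_pow, ← mul_assoc] at hnat
    have := Nat.le_of_mul_le_mul_right hnat (by positivity)
    rw [one_div, inv_pow, ← div_eq_mul_inv, le_div_iff₀ (by positivity)]
    exact_mod_cast this
  calc _ ≤ ((∑ l ∈ Ico (j + 1) (k + 1), #(({M ∈ A | Minimal (· ∈ A) M ∧ #M = l} :
          Finset _).biUnion fun M => univ.filter fun σ : Equiv.Perm (Fin n) =>
            ∀ e ∈ M, permGraph σ e = true) : ℕ) : ℝ) := by
        exact_mod_cast (card_le_card hsub).trans card_biUnion_le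
    _ ≤ ∑ l ∈ Ico (j + 1) (k + 1), n.factorial * (1 / 4 : ℝ) ^ l := by
        rw [Nat.cast_sum]; exact sum_le_sum hl
    _ = n.factorial * ∑ l ∈ Ico (j + 1) (k + 1), (1 / 4 : ℝ) ^ l := by rw [mul_sum]
    _ ≤ n.factorial * ((1 / 4 : ℝ) ^ (j + 1) / (1 - 1 / 4)) := by
        gcongr
        exact geom_sum_Ico_le_of_lt_one (by norm_num) (by norm_num)
    _ = _ := by rw [pow_succ]; ring

theorem Accepts.exists_minimal {A : Finset (Finset (Fin n × Fin n))} {x : Fin n × Fin n → Bool}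
    (h : Accepts A x) : ∃ M, Minimal (· ∈ A) M ∧ ∀ e ∈ M, x e = true := by
  obtain ⟨M, hM, hMx⟩ := h
  obtain ⟨M', hM'M, hmin⟩ := exists_minimal_le_of_wellFoundedLT (· ∈ A) M hM
  exact ⟨M', hmin, fun e he => hMx e (hM'M he)⟩

open Classical in
theorem IsClosedFamily.card_permGraph_inter_error_le {j m r : ℕ} (hm : m ≠ 0) (hr : 0 < r)
    (hkr : 32 * (2 * j) * m ^ 2 ≤ r) (hrn : 4 * r + 2 * j ≤ n)
    {A B : Finset (Finset (Fin n × Fin n))}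
    (hA : IsClosedFamily (2 * j) m A) (hB : IsClosedFamily (2 * j) m B) :
    (#{σ : Equiv.Perm (Fin n) | Accepts A (permGraph σ) ∧ Accepts B (permGraph σ) ∧
      ¬ Accepts (A ∩ B) (permGraph σ)} : ℝ) ≤ n.factorial * (1 / 4) ^ j := by
  have hsub : univ.filter (fun σ : Equiv.Perm (Fin n) => Accepts A (permGraph σ) ∧
      Accepts B (permGraph σ) ∧ ¬ Accepts (A ∩ B) (permGraph σ)) ⊆
      univ.filter (fun σ : Equiv.Perm (Fin n) =>
        ∃ M, Minimal (· ∈ A) M ∧ j < #M ∧ ∀ e ∈ M, permGraph σ e = true) ∪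
      univ.filter (fun σ : Equiv.Perm (Fin n) =>
        ∃ M, Minimal (· ∈ B) M ∧ j < #M ∧ ∀ e ∈ M, permGraph σ e = true) := by
    intro σ hσ
    obtain ⟨hAσ, hBσ, hno⟩ := (mem_filter.1 hσ).2
    obtain ⟨M, hM, hMσ⟩ := hAσ.exists_minimal
    obtain ⟨N, hN, hNσ⟩ := hBσ.exists_minimal
    simp only [mem_union, mem_filter, mem_univ, true_and]
    by_contra! hcon
    have h1 : #M ≤ j := by
      by_contra! h
      obtain ⟨e, he, hne⟩ := hcon.1 M hM h
      exact hne (hMσ e he)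
    have h2 : #N ≤ j := by
      by_contra! h
      obtain ⟨e, he, hne⟩ := hcon.2 N hN h
      exact hne (hNσ e he)
    have hunion : ∀ e ∈ M ∪ N, permGraph σ e = true := fun e he =>
      (mem_union.1 he).elim (hMσ e) (hNσ e)
    have hmatch : IsMatching (M ∪ N) := by
      intro e he e' he' hne
      have q := hunion e he
      have q' := hunion e' he'
      simp only [permGraph, decide_eq_true_eq] at q q'
      refine ⟨fun h => hne (Prod.ext h (by rw [← q, ← q', h])), fun h => hne (Prod.ext ?_ h)⟩
      exact σ.injective (by rw [q, q', h])
    have hc : #(M ∪ N) ≤ 2 * j := (card_union_le M N).trans (by omega)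
    exact hno ⟨M ∪ N, mem_inter.2 ⟨hA.mem_of_subset hM.prop subset_union_left hmatch hc,
      hB.mem_of_subset hN.prop subset_union_right hmatch hc⟩, hunion⟩
  have hle : (#{σ : Equiv.Perm (Fin n) | Accepts A (permGraph σ) ∧ Accepts B (permGraph σ) ∧
      ¬ Accepts (A ∩ B) (permGraph σ)} : ℝ) ≤ _ :=
    Nat.cast_le.2 ((card_le_card hsub).trans (card_union_le _ _))
  rw [Nat.cast_add] at hle
  have h1 := hA.card_permGraph_large_minimal_le hm hr hkr hrn j
  have h2 := hB.card_permGraph_large_minimal_le hm hr hkr hrn j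
  have : (0 : ℝ) ≤ n.factorial * (1 / 4) ^ j := by positivity
  linarith

/-- Unbalanced two-colourings give graphs without a perfect matching. -/
theorem card_eq_of_matchProp_colorGraph {C : Finset (Fin n ⊕ Fin n)}
    (h : MatchProp n (colorGraph C)) : #C.toLeft = #C.toRight := by
  obtain ⟨M, hM, hcard, hMC⟩ := h
  have hf : M.image Prod.fst = univ := by
    rw [← card_eq_iff_eq_univ, hM.card_image_fst, hcard, Fintype.card_fin]
  have hs : M.image Prod.snd = univ := by
    rw [← card_eq_iff_eq_univ, hM.card_image_snd, hcard, Fintype.card_fin]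
  have hsub : IsMatching {e ∈ M | Sum.inl e.1 ∈ C} := hM.mono (filter_subset _ _)
  have h1 : ({e ∈ M | Sum.inl e.1 ∈ C} : Finset _).image Prod.fst = C.toLeft := by
    ext u
    simp only [mem_image, mem_filter, mem_toLeft]
    constructor
    · rintro ⟨e, he, rfl⟩; exact he.2
    · intro hu
      obtain ⟨e, he, rfl⟩ := mem_image.1 (hf ▸ mem_univ u)
      exact ⟨e, ⟨he, hu⟩, rfl⟩
  have h2 : ({e ∈ M | Sum.inl e.1 ∈ C} : Finset _).image Prod.snd = C.toRight := by
    ext v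
    simp only [mem_image, mem_filter, mem_toRight]
    constructor
    · rintro ⟨e, he, rfl⟩
      have := hMC e he.1
      simp only [colorGraph, decide_eq_true_eq] at this
      exact this.1 he.2
    · intro hv
      obtain ⟨e, he, rfl⟩ := mem_image.1 (hs ▸ mem_univ v)
      have := hMC e he
      simp only [colorGraph, decide_eq_true_eq] at this
      exact ⟨e, ⟨he, this.2 hv⟩, rfl⟩
  rw [← h1, ← h2, hsub.card_image_fst, hsub.card_image_snd]

open Classical in
theorem four_pow_le_card_unbalanced (hn : 0 < n) :
    4 ^ n ≤ 2 * #{C : Finset (Fin n ⊕ Fin n) | ¬ MatchProp n (colorGraph C)} := by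
  have htot : #(univ : Finset (Finset (Fin n ⊕ Fin n))) = 4 ^ n := by
    rw [card_univ, Fintype.card_finset, Fintype.card_sum, Fintype.card_fin, ← two_mul, pow_mul]
    norm_num
  rw [← htot, ← card_filter_add_card_filter_not (fun C => MatchProp n (colorGraph C)), two_mul]
  refine Nat.add_le_add_right ?_ _
  set w : Fin n ⊕ Fin n := Sum.inl ⟨0, hn⟩ with hw
  refine card_le_card_of_injOn (fun C => symmDiff C {w}) ?_
    fun C _ D _ h => symmDiff_left_injective _ h
  intro C hC
  simp only [coe_filter, mem_univ, true_and, Set.mem_ofPred_eq] at hC ⊢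
  intro hD
  have h1 := card_eq_of_matchProp_colorGraph hC
  have h2 := card_eq_of_matchProp_colorGraph hD
  have h3 : (symmDiff C {w}).toRight = C.toRight := by
    ext v; simp [mem_symmDiff, hw]
  rw [h3] at h2
  by_cases hwC : w ∈ C
  · have h4 : (symmDiff C {w}).toLeft = C.toLeft.erase ⟨0, hn⟩ := by
      ext u
      simp only [mem_toLeft, mem_symmDiff, mem_singleton, hw, Sum.inl.injEq, mem_erase] at hwC ⊢
      by_cases hu : u = ⟨0, hn⟩
      · subst hu; simp [hwC]
      · simp [hu]
    have hmem : (⟨0, hn⟩ : Fin n) ∈ C.toLeft := mem_toLeft.2 hwC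
    rw [h4, card_erase_of_mem hmem] at h2
    have := card_pos.2 ⟨_, hmem⟩
    omega
  · have h4 : (symmDiff C {w}).toLeft = insert ⟨0, hn⟩ C.toLeft := by
      ext u
      simp only [mem_toLeft, mem_symmDiff, mem_singleton, hw, Sum.inl.injEq, mem_insert] at hwC ⊢
      by_cases hu : u = ⟨0, hn⟩
      · subst hu; simp [hwC]
      · simp [hu]
    have hmem : (⟨0, hn⟩ : Fin n) ∉ C.toLeft := fun h => hwC (mem_toLeft.1 h)
    rw [h4, card_insert_of_notMem hmem] at h2
    omega

/-- Evaluation of a monotone circuit with values in an arbitrary type. -/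
def MonCircuit.interp {ι β : Type} (C : MonCircuit ι) (inp : ι → β) (op : Bool → β → β → β) :
    (i : Fin C.size) → β
  | i =>
    match C.gate i with
    | Sum.inl j => inp j
    | Sum.inr (b, j, k) =>
      op b (C.interp inp op ⟨j.val, j.isLt.trans i.isLt⟩)
        (C.interp inp op ⟨k.val, k.isLt.trans i.isLt⟩)
  termination_by i => i.val

/-- If each gate adds at most `b` errors to those of the earlier gates, then every gate has at most
`s * b` errors. -/
theorem card_not_le_of_local_errors {I : Type*} [Fintype I] {s : ℕ} (P : Fin s → I → Prop) {b : ℝ}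
    (hlocal : ∀ i, ∃ E : Finset I, (#E : ℝ) ≤ b ∧ ∀ t ∉ E, (∀ j < i, P j t) → P i t) (i : Fin s)
    [DecidablePred fun t => ¬ P i t] :
    (#{t | ¬ P i t} : ℝ) ≤ s * b := by
  classical
  choose E hEb hE using hlocal
  have hsub : univ.filter (fun t => ¬ P i t) ⊆ univ.biUnion E := by
    intro t ht
    by_contra hno
    simp only [mem_biUnion, mem_univ, true_and, not_exists] at hno
    have hall : ∀ i, P i t := by
      intro i
      induction i using WellFoundedLT.induction with
      | ind i ih => exact hE i t (hno i) ih
    exact (mem_filter.1 ht).2 (hall i)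
  calc _ ≤ ((∑ i, #(E i) : ℕ) : ℝ) := by exact_mod_cast (card_le_card hsub).trans card_biUnion_le
    _ ≤ ∑ _i : Fin s, b := by rw [Nat.cast_sum]; exact sum_le_sum fun i _ => hEb i
    _ = _ := by simp

theorem four_pow_le_two_mul_size {j m r : ℕ} (hm : m ≠ 0) (hr : 0 < r)
    (hkr : 32 * (2 * j) * m ^ 2 ≤ r) (hrn : 4 * r + 2 * j ≤ n) (hj : 1 ≤ j)
    (hjm : (n ^ 2 + 1) ^ (2 * j) * 4 ^ j ≤ 4 ^ m)
    (C : MonCircuit (Fin n × Fin n)) (hC : C.Computes (MatchProp n)) :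
    (4 : ℝ) ^ j ≤ 2 * C.size := by
  classical
  obtain ⟨hs, hC⟩ := hC
  set S : ℕ := #({M | IsMatching M ∧ #M ≤ 2 * j} : Finset (Finset (Fin n × Fin n)))
  have hSle : S * 4 ^ j ≤ 4 ^ m := by
    refine le_trans (Nat.mul_le_mul_right _ ?_) hjm
    calc S ≤ #{M : Finset (Fin n × Fin n) | #M ≤ 2 * j} :=
          card_le_card fun M hM => by simp only [mem_filter] at hM ⊢; exact ⟨hM.1, hM.2.2⟩
      _ ≤ _ := card_finset_card_le _
      _ = _ := by simp [sq]
  have hclos : ∀ A : {A : Finset (Finset (Fin n × Fin n)) // ∀ M ∈ A, IsMatching M ∧ #M ≤ 2 * j},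
      ∃ B, A.1 ⊆ B ∧ IsClosedFamily (2 * j) m B ∧
        #{C : Finset (Fin n ⊕ Fin n) |
          Accepts B (colorGraph C) ∧ ¬ Accepts A.1 (colorGraph C)} * 4 ^ m ≤ S * 4 ^ n := by
    intro A
    obtain ⟨B, h1, h2, h3⟩ := exists_isClosedFamily (2 * j) m A.1 A.2
    exact ⟨B, h1, h2, h3.trans (Nat.mul_le_mul_right _ (card_le_card sdiff_subset))⟩
  clear_value S
  choose cl hsub hcl herr using hclos
  let β := {A : Finset (Finset (Fin n × Fin n)) // IsClosedFamily (2 * j) m A}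
  have hsingle : ∀ e : Fin n × Fin n, ∀ M ∈ ({{e}} : Finset (Finset (Fin n × Fin n))),
      IsMatching M ∧ #M ≤ 2 * j := by
    intro e M hM
    rw [mem_singleton] at hM
    subst hM
    refine ⟨fun a ha b hb hne => ?_, by rw [card_singleton]; omega⟩
    rw [mem_singleton] at ha hb
    exact absurd (ha.trans hb.symm) hne
  have hunion : ∀ A B : β, ∀ M ∈ A.1 ∪ B.1, IsMatching M ∧ #M ≤ 2 * j := fun A B M hM =>
    (mem_union.1 hM).elim (fun h => ⟨A.2.isMatching M h, A.2.card_le M h⟩)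
      (fun h => ⟨B.2.isMatching M h, B.2.card_le M h⟩)
  let inp : Fin n × Fin n → β := fun e => ⟨cl ⟨{{e}}, hsingle e⟩, hcl _⟩
  let op : Bool → β → β → β := fun b A B =>
    if b then ⟨A.1 ∩ B.1, A.2.inter B.2⟩ else ⟨cl ⟨A.1 ∪ B.1, hunion A B⟩, hcl _⟩
  let T : Fin C.size → β := C.interp inp op
  have hpos : ∀ i, (#{σ : Equiv.Perm (Fin n) |
      ¬ (C.eval (permGraph σ) i = true → Accepts (T i).1 (permGraph σ))} : ℝ)
      ≤ C.size * (n.factorial * (1 / 4) ^ j) := by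
    refine fun o => card_not_le_of_local_errors
      (fun i σ => C.eval (permGraph σ) i = true → Accepts (T i).1 (permGraph σ)) (fun i => ?_) o
    rcases hg : C.gate i with e | ⟨b, a, a'⟩
    · refine ⟨∅, by rw [card_empty, Nat.cast_zero]; positivity, fun σ _ _ hev => ?_⟩
      rw [MonCircuit.eval, hg] at hev
      simp only [T]
      rw [MonCircuit.interp, hg]
      exact ⟨{e}, hsub _ (mem_singleton_self _), by simpa using hev⟩
    · set ia : Fin C.size := ⟨a.val, a.isLt.trans i.isLt⟩
      set ia' : Fin C.size := ⟨a'.val, a'.isLt.trans i.isLt⟩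
      have hT : T i = op b (T ia) (T ia') := by
        simp only [T]
        rw [MonCircuit.interp, hg]
      rcases b with _ | _
      · refine ⟨∅, by rw [card_empty, Nat.cast_zero]; positivity, fun σ _ hprev hev => ?_⟩
        rw [MonCircuit.eval, hg] at hev
        have hev' : C.eval (permGraph σ) ia = true ∨ C.eval (permGraph σ) ia' = true := by
          simpa using hev
        rw [hT]
        rcases hev' with h | h
        · obtain ⟨M, hM, hMσ⟩ := hprev ia a.isLt h
          exact ⟨M, hsub _ (mem_union_left _ hM), hMσ⟩
        · obtain ⟨M, hM, hMσ⟩ := hprev ia' a'.isLt h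
          exact ⟨M, hsub _ (mem_union_right _ hM), hMσ⟩
      · refine ⟨_, (T ia).2.card_permGraph_inter_error_le hm hr hkr hrn (T ia').2,
          fun σ hσ hprev hev => ?_⟩
        rw [MonCircuit.eval, hg] at hev
        have hev' : C.eval (permGraph σ) ia = true ∧ C.eval (permGraph σ) ia' = true := by
          simpa using hev
        rw [hT]
        by_contra hno
        exact hσ (mem_filter.2 ⟨mem_univ _, hprev ia a.isLt hev'.1, hprev ia' a'.isLt hev'.2, hno⟩)
  have hneg : ∀ i, (#{D : Finset (Fin n ⊕ Fin n) |
      ¬ (Accepts (T i).1 (colorGraph D) → C.eval (colorGraph D) i = true)} : ℝ)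
      ≤ C.size * (S * 4 ^ n / 4 ^ m) := by
    refine fun o => card_not_le_of_local_errors
      (fun i D => Accepts (T i).1 (colorGraph D) → C.eval (colorGraph D) i = true) (fun i => ?_) o
    have herr' : ∀ A, (#{D : Finset (Fin n ⊕ Fin n) |
          Accepts (cl A) (colorGraph D) ∧ ¬ Accepts A.1 (colorGraph D)} : ℝ)
          ≤ S * 4 ^ n / 4 ^ m := by
      intro A
      rw [le_div_iff₀ (by positivity)]
      exact_mod_cast herr A
    rcases hg : C.gate i with e | ⟨b, a, a'⟩
    · refine ⟨_, herr' ⟨{{e}}, hsingle e⟩, fun D hD _ hacc => ?_⟩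
      have hT : T i = inp e := by
        simp only [T]
        rw [MonCircuit.interp, hg]
      rw [hT] at hacc
      have : Accepts {{e}} (colorGraph D) := by
        by_contra hno
        exact hD (mem_filter.2 ⟨mem_univ _, hacc, hno⟩)
      rw [MonCircuit.eval, hg]
      obtain ⟨M, hM, hMD⟩ := this
      rw [mem_singleton] at hM
      subst hM
      exact hMD e (mem_singleton_self e)
    · set ia : Fin C.size := ⟨a.val, a.isLt.trans i.isLt⟩
      set ia' : Fin C.size := ⟨a'.val, a'.isLt.trans i.isLt⟩
      have hT : T i = op b (T ia) (T ia') := by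
        simp only [T]
        rw [MonCircuit.interp, hg]
      rcases b with _ | _
      · refine ⟨_, herr' ⟨(T ia).1 ∪ (T ia').1, hunion _ _⟩, fun D hD hprev hacc => ?_⟩
        rw [hT] at hacc
        have : Accepts ((T ia).1 ∪ (T ia').1) (colorGraph D) := by
          by_contra hno
          exact hD (mem_filter.2 ⟨mem_univ _, hacc, hno⟩)
        obtain ⟨M, hM, hMD⟩ := this
        have hev : C.eval (colorGraph D) ia = true ∨ C.eval (colorGraph D) ia' = true :=
          (mem_union.1 hM).imp (fun h => hprev ia a.isLt ⟨M, h, hMD⟩)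
            (fun h => hprev ia' a'.isLt ⟨M, h, hMD⟩)
        rw [MonCircuit.eval, hg]
        simpa using hev
      · refine ⟨∅, by rw [card_empty, Nat.cast_zero]; positivity, fun D _ hprev hacc => ?_⟩
        rw [hT] at hacc
        obtain ⟨M, hM, hMD⟩ := hacc
        have hM' : M ∈ (T ia).1 ∩ (T ia').1 := hM
        have hev : C.eval (colorGraph D) ia = true ∧ C.eval (colorGraph D) ia' = true :=
          ⟨hprev ia a.isLt ⟨M, (mem_inter.1 hM').1, hMD⟩,
            hprev ia' a'.isLt ⟨M, (mem_inter.1 hM').2, hMD⟩⟩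
        rw [MonCircuit.eval, hg]
        simpa using hev
  set o : Fin C.size := ⟨C.size - 1, Nat.sub_lt hs Nat.one_pos⟩
  by_cases hempty : ∅ ∈ (T o).1
  · have hle : (#{D : Finset (Fin n ⊕ Fin n) | ¬ MatchProp n (colorGraph D)} : ℝ)
        ≤ C.size * (S * 4 ^ n / 4 ^ m) := by
      refine le_trans (Nat.cast_le.2 (card_le_card fun D hD => ?_)) (hneg o)
      simp only [mem_filter, mem_univ, true_and] at hD ⊢
      intro h
      exact hD ((hC _).1 (h ⟨∅, hempty, by simp⟩))
    have h4 : (4 : ℝ) ^ n ≤ 2 * #{D : Finset (Fin n ⊕ Fin n) | ¬ MatchProp n (colorGraph D)} := by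
      exact_mod_cast four_pow_le_card_unbalanced (by omega)
    have hS' : (S : ℝ) * 4 ^ j ≤ 4 ^ m := by exact_mod_cast hSle
    have h5 : (4 : ℝ) ^ n ≤ 2 * (C.size * (S * 4 ^ n / 4 ^ m)) := by linarith
    have h6 : (4 : ℝ) ^ m ≤ 2 * C.size * S := by
      have : 2 * ((C.size : ℝ) * (S * 4 ^ n / 4 ^ m)) = 4 ^ n * (2 * C.size * S / 4 ^ m) := by ring
      rw [this] at h5
      have := (le_mul_iff_one_le_right (by positivity : (0 : ℝ) < 4 ^ n)).1 h5
      rwa [one_le_div (by positivity)] at this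
    have hS0 : (0 : ℝ) < S := by
      by_contra! h
      have : (0 : ℝ) < 4 ^ m := by positivity
      nlinarith [(Nat.cast_nonneg C.size : (0 : ℝ) ≤ C.size)]
    nlinarith
  · have hacc : (#{σ : Equiv.Perm (Fin n) | Accepts (T o).1 (permGraph σ)} : ℝ)
        ≤ n.factorial / 3 := by
      have h := (T o).2.card_permGraph_large_minimal_le hm hr hkr hrn 0
      rw [pow_zero, mul_one] at h
      refine le_trans (Nat.cast_le.2 (card_le_card fun σ hσ => ?_)) h
      simp only [mem_filter, mem_univ, true_and] at hσ ⊢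
      obtain ⟨M, hM, hMσ⟩ := hσ.exists_minimal
      refine ⟨M, hM, card_pos.2 (nonempty_iff_ne_empty.2 ?_), hMσ⟩
      rintro rfl
      exact hempty hM.prop
    have hrej : (#{σ : Equiv.Perm (Fin n) | ¬ Accepts (T o).1 (permGraph σ)} : ℝ)
        ≤ C.size * (n.factorial * (1 / 4) ^ j) := by
      refine le_trans (Nat.cast_le.2 (card_le_card fun σ hσ => ?_)) (hpos o)
      simp only [mem_filter, mem_univ, true_and] at hσ ⊢
      exact fun h => hσ (h ((hC _).2 (matchProp_permGraph σ)))
    have htot : (#{σ : Equiv.Perm (Fin n) | Accepts (T o).1 (permGraph σ)} : ℝ)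
        + #{σ : Equiv.Perm (Fin n) | ¬ Accepts (T o).1 (permGraph σ)} = n.factorial := by
      rw [← Nat.cast_add, card_filter_add_card_filter_not, card_univ, Fintype.card_perm,
        Fintype.card_fin]
    have hfac : (0 : ℝ) < n.factorial := by exact_mod_cast n.factorial_pos
    have h7 : (n.factorial : ℝ) * (2 / 3) ≤ n.factorial * (C.size * (1 / 4) ^ j) := by linarith
    have h8 := le_of_mul_le_mul_left h7 hfac
    rw [one_div, inv_pow, ← div_eq_mul_inv, le_div_iff₀ (by positivity)] at h8
    have : (0 : ℝ) < 4 ^ j := by positivity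
    linarith

theorem two_pow_le_size {j : ℕ} (hj : 1 ≤ j) (hjn : 2306 * j ^ 3 * (Nat.log 2 n + 1) ^ 2 ≤ n)
    (C : MonCircuit (Fin n × Fin n)) (hC : C.Computes (MatchProp n)) :
    (2 : ℝ) ^ j ≤ C.size := by
  set L := Nat.log 2 n + 1 with hL
  have hL1 : 1 ≤ L := by omega
  have h := four_pow_le_two_mul_size (n := n) (j := j) (m := 3 * j * L)
    (r := 32 * (2 * j) * (3 * j * L) ^ 2) (by positivity) (by positivity) le_rfl (by
      refine le_trans ?_ hjn
      have : j * 1 ≤ j * (j ^ 2 * L ^ 2) :=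
        Nat.mul_le_mul_left _ (Nat.one_le_iff_ne_zero.2 (by positivity))
      nlinarith) hj (by
      have hlt : n < 2 ^ L := Nat.lt_pow_succ_log_self (by norm_num) n
      have h4 : n ^ 2 + 1 ≤ 4 ^ L := by
        have : (4 : ℕ) ^ L = 2 ^ L * 2 ^ L := by rw [← mul_pow]; norm_num
        nlinarith
      calc (n ^ 2 + 1) ^ (2 * j) * 4 ^ j ≤ (4 ^ L) ^ (2 * j) * 4 ^ j := by gcongr
        _ = 4 ^ (L * (2 * j) + j) := by rw [← pow_mul, ← pow_add]
        _ ≤ _ := Nat.pow_le_pow_right (by norm_num) (by nlinarith)) C hC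
  have h2 : (2 : ℝ) ≤ 2 ^ j := by
    calc (2 : ℝ) = 2 ^ 1 := by norm_num
      _ ≤ 2 ^ j := pow_le_pow_right₀ (by norm_num) hj
  have h4 : (4 : ℝ) ^ j = 2 ^ j * 2 ^ j := by rw [← mul_pow]; norm_num
  nlinarith

theorem eventually_log_bound {δ : ℝ} (hδ : 0 < δ) (hδ3 : δ < 1 / 3) :
    ∀ᶠ n : ℕ in Filter.atTop,
      2306 * ⌈(n : ℝ) ^ (1 / 3 - δ)⌉₊ ^ 3 * (Nat.log 2 n + 1) ^ 2 ≤ n := by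
  have h1 := ((isLittleO_log_rpow_atTop (show 0 < 3 * δ / 2 by positivity)).bound
    (show (0 : ℝ) < 1 / 1000 by norm_num)).natCast_atTop
  filter_upwards [h1, Filter.eventually_ge_atTop 3] with n hlog hn
  have hn0 : (0 : ℝ) < n := by exact_mod_cast (by omega : 0 < n)
  have hn1 : (1 : ℝ) ≤ n := by exact_mod_cast (by omega : 1 ≤ n)
  have hlog1 : 1 ≤ Real.log n := by
    rw [Real.le_log_iff_exp_le hn0]
    have : (3 : ℝ) ≤ n := by exact_mod_cast hn
    linarith [Real.exp_one_lt_d9]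
  rw [Real.norm_of_nonneg (by linarith), Real.norm_of_nonneg (by positivity)] at hlog
  have hL : ((Nat.log 2 n : ℕ) : ℝ) + 1 ≤ 3 * Real.log n := by
    have h2 : ((2 ^ Nat.log 2 n : ℕ) : ℝ) ≤ n := by
      exact_mod_cast Nat.pow_log_le_self 2 (by omega)
    have h3 := Real.log_le_log (by positivity) h2
    rw [Nat.cast_pow, Real.log_pow] at h3
    have h4 := Real.log_two_gt_d9
    have h5 : (0 : ℝ) ≤ (Nat.log 2 n : ℕ) := Nat.cast_nonneg _
    push_cast at h3
    nlinarith
  have hx1 : 1 ≤ (n : ℝ) ^ (1 / 3 - δ) := Real.one_le_rpow hn1 (by linarith)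
  have hj : (⌈(n : ℝ) ^ (1 / 3 - δ)⌉₊ : ℝ) ≤ 2 * (n : ℝ) ^ (1 / 3 - δ) := by
    have := Nat.ceil_lt_add_one (zero_le_one.trans hx1)
    linarith
  have hcomb : ((n : ℝ) ^ (1 / 3 - δ)) ^ 3 * ((n : ℝ) ^ (3 * δ / 2)) ^ 2 = n := by
    rw [← Real.rpow_natCast, ← Real.rpow_natCast, ← Real.rpow_mul hn0.le, ← Real.rpow_mul hn0.le,
      ← Real.rpow_add hn0]
    convert Real.rpow_one (n : ℝ) using 2
    push_cast; ring
  have hfin : (2306 * (⌈(n : ℝ) ^ (1 / 3 - δ)⌉₊ : ℝ) ^ 3 * ((Nat.log 2 n : ℕ) + 1 : ℝ) ^ 2) ≤ n :=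
    calc _ ≤ 2306 * (2 * (n : ℝ) ^ (1 / 3 - δ)) ^ 3 *
          (3 * (1 / 1000 * (n : ℝ) ^ (3 * δ / 2))) ^ 2 := by
          gcongr
          exact hL.trans (by linarith)
      _ = (2306 * 8 * 9 / 1000000) *
          (((n : ℝ) ^ (1 / 3 - δ)) ^ 3 * ((n : ℝ) ^ (3 * δ / 2)) ^ 2) := by
          ring
      _ ≤ n := by rw [hcomb]; linarith
  exact_mod_cast hfin

/-- For every `δ > 0` there is `N` such that for all `n ≥ N`, every monotone circuit
computing `Match_n` has size at least `2 ^ (n ^ (1/3 - δ))`. -/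
theorem match_monotone_lower_bound :
    ∀ δ : ℝ, 0 < δ → ∃ N : ℕ, ∀ n : ℕ, N ≤ n →
      ∀ C : MonCircuit (Fin n × Fin n), C.Computes (MatchProp n) →
        (2 : ℝ) ^ ((n : ℝ) ^ ((1 : ℝ) / 3 - δ)) ≤ (C.size : ℝ) := by
  intro δ hδ
  obtain ⟨N, hN⟩ := Filter.eventually_atTop.1
    (eventually_log_bound (lt_min hδ (by norm_num : (0 : ℝ) < 1 / 6))
      ((min_le_right _ _).trans_lt (by norm_num)))
  refine ⟨max N 1, fun n hn C hC => ?_⟩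
  have hn1 : (1 : ℝ) ≤ n := by exact_mod_cast (le_max_right N 1).trans hn
  set x : ℝ := (n : ℝ) ^ (1 / 3 - min δ (1 / 6)) with hx
  have hx0 : 0 < x := by positivity
  have hsize := two_pow_le_size (Nat.ceil_pos.2 hx0) (hN n ((le_max_left N 1).trans hn)) C hC
  calc (2 : ℝ) ^ ((n : ℝ) ^ ((1 : ℝ) / 3 - δ)) ≤ 2 ^ ((⌈x⌉₊ : ℕ) : ℝ) := by
        refine Real.rpow_le_rpow_of_exponent_le (by norm_num) (le_trans ?_ (Nat.le_ceil x))
        exact Real.rpow_le_rpow_of_exponent_le hn1 (by linarith [min_le_left δ (1 / 6)])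
    _ = 2 ^ ⌈x⌉₊ := Real.rpow_natCast _ _
    _ ≤ C.size := hsize
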